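/- Assume the coercivity conditions: S^j = Σ_{i=1}^{j} [κ_{i−1}(u_i−u_{i−1}) + d_i] ≥ 0 for all j = 1,…,n, and S_j = Σ_{i=j}^{n} [κ_i(u_{i+1}−u_i) + d_i] ≥ 0 for all j = 1,…,n. Then there exist real numbers ξ₁ < ξ₂ < ⋯ < ξ_n satisfying the Stefan system: for each i = 1,…,n, d_i ξ_i/2 + k_i(u_{i+1}−u_i) F'(ξ_i/a_i)/(a_i (F(ξ_{i+1}/a_i) − F(ξ_i/a_i))) − k_{i−1}(u_i−u_{i−1}) F'(ξ_i/a_{i−1})/(a_{i−1} (F(ξ_i/a_{i−1}) − F(ξ_{i−1}/a_{i−1}))) = 0, where ξ₀ = −∞ and ξ_{n+1} = +∞. (This gives an increasing self-similar solution of the multi-phase Stefan–Riemann problem.) -/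

import Mathlib

open Real Filter Finset

/-- The rescaled Gaussian cumulative distribution function
`F(ξ) = (1/(2√π)) ∫_{-∞}^{ξ} e^{-s²/4} ds`. -/
noncomputable def F (x : ℝ) : ℝ :=
  (1 / (2 * Real.sqrt Real.pi)) * ∫ s in Set.Iio x, Real.exp (-s ^ 2 / 4)

/-- The derivative `F'(ξ) = (1/(2√π)) e^{-ξ²/4}`. -/
noncomputable def F' (x : ℝ) : ℝ :=
  (1 / (2 * Real.sqrt Real.pi)) * Real.exp (-x ^ 2 / 4)

/-- The functional
`E(ξ̄) = −Σ_{i=0}^{n} k_i(u_{i+1}−u_i) ln(F(ξ_{i+1}/a_i) − F(ξ_i/a_i)) + Σ_{i=1}^{n} d_i ξ_i²/4`,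
with the conventions `ξ₀ = −∞`, `ξ_{n+1} = +∞`, i.e. `F(ξ₀/a₀) = 0`, `F(ξ_{n+1}/a_n) = 1`.
Here `ξ : ℕ → ℝ`, only the values `ξ 1, …, ξ n` being relevant. -/
noncomputable def E (n : ℕ) (u a k d : ℕ → ℝ) (ξ : ℕ → ℝ) : ℝ :=
  -(∑ i ∈ Finset.range (n + 1), k i * (u (i + 1) - u i) *
      Real.log ((if i = n then 1 else F (ξ (i + 1) / a i)) -
        (if i = 0 then 0 else F (ξ i / a i))))
  + ∑ i ∈ Finset.Icc 1 n, d i * ξ i ^ 2 / 4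

/-- Reindexing of a point of `ℝⁿ` as the sequence `ξ_1, …, ξ_n` (paper indexing). -/
noncomputable def toSeq (n : ℕ) (x : EuclideanSpace ℝ (Fin n)) : ℕ → ℝ :=
  fun i => if h : i - 1 < n then x ⟨i - 1, h⟩ else 0

/-- The left-hand side of the `i`-th equation (`1 ≤ i ≤ n`) of the Stefan system:
`d_i ξ_i/2 + k_i(u_{i+1}−u_i) F'(ξ_i/a_i)/(a_i (F(ξ_{i+1}/a_i) − F(ξ_i/a_i)))
 − k_{i−1}(u_i−u_{i−1}) F'(ξ_i/a_{i−1})/(a_{i−1} (F(ξ_i/a_{i−1}) − F(ξ_{i−1}/a_{i−1})))`,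
with the conventions `ξ₀ = −∞` (so `F(ξ₀/a₀) = 0`) and `ξ_{n+1} = +∞` (so `F(ξ_{n+1}/a_n) = 1`). -/
noncomputable def stefanLHS (n : ℕ) (u a k d : ℕ → ℝ) (ξ : ℕ → ℝ) (i : ℕ) : ℝ :=
  d i * ξ i / 2
  + k i * (u (i + 1) - u i) * F' (ξ i / a i) /
      (a i * ((if i = n then 1 else F (ξ (i + 1) / a i)) - F (ξ i / a i)))
  - k (i - 1) * (u i - u (i - 1)) * F' (ξ i / a (i - 1)) /
      (a (i - 1) * (F (ξ i / a (i - 1)) - (if i = 1 then 0 else F (ξ (i - 1) / a (i - 1)))))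

theorem integrable_exp_neg_sq_div_four :
    MeasureTheory.Integrable fun s : ℝ => exp (-s ^ 2 / 4) := by
  refine (integrable_exp_neg_mul_sq (b := 1 / 4) (by norm_num)).congr (.of_forall fun s => ?_)
  simp only
  congr 1
  ring

theorem F_eq_integral_Iic (x : ℝ) :
    F x = (1 / (2 * √π)) * ∫ s in Set.Iic x, exp (-s ^ 2 / 4) := by
  rw [F, MeasureTheory.integral_Iic_eq_integral_Iio]

theorem hasDerivAt_F (x : ℝ) : HasDerivAt F (F' x) x := by
  have hc : Continuous fun s : ℝ => exp (-s ^ 2 / 4) := by fun_prop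
  have h : F = fun y => (1 / (2 * √π)) *
      ((∫ s in (0 : ℝ)..y, exp (-s ^ 2 / 4)) + ∫ s in Set.Iic 0, exp (-s ^ 2 / 4)) := by
    funext y
    rw [F_eq_integral_Iic, ← intervalIntegral.integral_Iic_sub_Iic
      integrable_exp_neg_sq_div_four.integrableOn integrable_exp_neg_sq_div_four.integrableOn]
    ring
  rw [h]
  exact ((intervalIntegral.integral_hasDerivAt_right (hc.intervalIntegrable _ _)
    (hc.stronglyMeasurableAtFilter _ _) hc.continuousAt).add_const _).const_mul _

theorem continuous_F : Continuous F :=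
  continuous_iff_continuousAt.2 fun x => (hasDerivAt_F x).continuousAt

theorem strictMono_F : StrictMono F :=
  strictMono_of_hasDerivAt_pos hasDerivAt_F fun x => by unfold F'; positivity

theorem F_nonneg (x : ℝ) : 0 ≤ F x :=
  mul_nonneg (by positivity) (MeasureTheory.integral_nonneg fun _ => (exp_pos _).le)

theorem F_pos (x : ℝ) : 0 < F x :=
  (F_nonneg (x - 1)).trans_lt (strictMono_F (by linarith))

theorem F_neg_eq_integral_Ioi (x : ℝ) :
    F (-x) = (1 / (2 * √π)) * ∫ s in Set.Ioi x, exp (-s ^ 2 / 4) := by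
  rw [F_eq_integral_Iic, ← integral_comp_neg_Ioi]
  simp

theorem F_add_F_neg (x : ℝ) : F x + F (-x) = 1 := by
  rw [F_eq_integral_Iic, F_neg_eq_integral_Ioi, ← mul_add,
    intervalIntegral.integral_Iic_add_Ioi integrable_exp_neg_sq_div_four.integrableOn
      integrable_exp_neg_sq_div_four.integrableOn]
  have h : ∫ s : ℝ, exp (-s ^ 2 / 4) = √(π / (1 / 4)) := by
    rw [← integral_gaussian]
    congr with s
    ring_nf
  rw [h, show π / (1 / 4) = 2 ^ 2 * π by ring, Real.sqrt_mul (by positivity),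
    Real.sqrt_sq (by norm_num)]
  have := Real.sqrt_pos.2 Real.pi_pos
  field_simp

theorem F_lt_one (x : ℝ) : F x < 1 := by
  linarith [F_add_F_neg x, F_pos (-x)]

/-- The Mills-ratio bound for the Gaussian tail. -/
theorem F_neg_le {x : ℝ} (hx : 0 ≤ x) : F (-x) ≤ exp (-x ^ 2 / 4) / (1 + x) := by
  let g' : ℝ → ℝ := fun s => -(exp (-s ^ 2 / 4) * (s / (2 * (1 + s)) + 1 / (1 + s) ^ 2))
  have hd : ∀ s ∈ Set.Ici x, HasDerivAt (fun s : ℝ => exp (-s ^ 2 / 4) / (1 + s)) (g' s) s := by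
    intro s hs
    have hs' : 1 + s ≠ 0 := by have : x ≤ s := hs; linarith
    have h1 : HasDerivAt (fun s : ℝ => -s ^ 2 / 4) (-(2 * s) / 4) s := by
      simpa using ((hasDerivAt_pow 2 s).neg.div_const 4)
    refine (h1.exp.div ((hasDerivAt_id s).const_add 1) hs').congr_deriv ?_
    simp only [g', id]
    field_simp
    ring
  have hneg : ∀ s ∈ Set.Ioi x, g' s ≤ 0 := by
    intro s hs
    have : 0 < s := hx.trans_lt hs
    simp only [g', Left.neg_nonpos_iff]
    positivity
  have hlim : Tendsto (fun s : ℝ => exp (-s ^ 2 / 4) / (1 + s)) atTop (nhds 0) := by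
    refine squeeze_zero' (g := fun s => (1 + s)⁻¹) ?_ ?_
      (tendsto_inv_atTop_zero.comp (tendsto_atTop_add_const_left _ _ tendsto_id))
    · filter_upwards [eventually_ge_atTop 0] with s hs
      positivity
    · filter_upwards [eventually_ge_atTop 0] with s hs
      rw [div_eq_mul_inv]
      refine mul_le_of_le_one_left (by positivity) (exp_le_one_iff.2 ?_)
      nlinarith [sq_nonneg s]
  have hg_int := MeasureTheory.integrableOn_Ioi_deriv_of_nonpos' hd hneg hlim
  have hval := MeasureTheory.integral_Ioi_of_hasDerivAt_of_tendsto' hd hg_int hlim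
  have hsqrt : 3 / 2 ≤ √π := Real.le_sqrt_of_sq_le (by linarith [Real.pi_gt_three])
  have hle : ∫ s in Set.Ioi x, (1 / (2 * √π)) * exp (-s ^ 2 / 4) ≤ ∫ s in Set.Ioi x, -g' s := by
    refine MeasureTheory.setIntegral_mono_on
      (integrable_exp_neg_sq_div_four.integrableOn.const_mul _) hg_int.neg measurableSet_Ioi ?_
    intro s hs
    have hs0 : 0 < s := hx.trans_lt hs
    simp only [g', neg_neg]
    rw [mul_comm]
    refine mul_le_mul_of_nonneg_left ?_ (exp_pos _).le
    calc 1 / (2 * √π) ≤ 1 / 3 := by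
          apply one_div_le_one_div_of_le <;> linarith
      _ ≤ s / (2 * (1 + s)) + 1 / (1 + s) ^ 2 := by
          rw [div_add_div _ _ (by positivity) (by positivity), div_le_div_iff₀ (by norm_num)
            (by positivity)]
          nlinarith [mul_nonneg hs0.le (sq_nonneg (s - 1)), sq_nonneg (s - 1), pow_pos hs0 3]
  rw [MeasureTheory.integral_const_mul, ← F_neg_eq_integral_Ioi, MeasureTheory.integral_neg, hval]
    at hle
  linarith

/-- The argument of the `i`-th logarithm in `E`. -/
noncomputable def gap (n : ℕ) (a ξ : ℕ → ℝ) (i : ℕ) : ℝ :=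
  (if i = n then 1 else F (ξ (i + 1) / a i)) - (if i = 0 then 0 else F (ξ i / a i))

theorem continuous_gap (n : ℕ) (a : ℕ → ℝ) (i : ℕ) : Continuous fun ξ => gap n a ξ i := by
  unfold gap
  refine Continuous.sub ?_ ?_ <;> split_ifs <;>
    first
    | exact continuous_const
    | exact continuous_F.comp ((continuous_apply _).div_const _)

theorem lt_of_gap_pos {n i : ℕ} {a ξ : ℕ → ℝ} (hi : i ≠ 0) (hin : i ≠ n) (ha : 0 < a i)
    (h : 0 < gap n a ξ i) : ξ i < ξ (i + 1) := by
  simp only [gap, hi, hin, if_false, sub_pos] at h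
  exact (div_lt_div_iff_of_pos_right ha).1 (strictMono_F.lt_iff_lt.1 h)

theorem gap_pos_of_lt {n i : ℕ} {a ξ : ℕ → ℝ} (ha : 0 < a i)
    (h : i ≠ 0 → i ≠ n → ξ i < ξ (i + 1)) : 0 < gap n a ξ i := by
  unfold gap
  split_ifs with h1 h2 h2
  · norm_num
  · linarith [F_lt_one (ξ i / a i)]
  · linarith [F_pos (ξ (i + 1) / a i)]
  · exact sub_pos.2 (strictMono_F (div_lt_div_of_pos_right (h h2 h1) ha))

theorem gap_le_one (n : ℕ) (a ξ : ℕ → ℝ) (i : ℕ) : gap n a ξ i ≤ 1 := by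
  unfold gap
  split_ifs <;> linarith [F_lt_one (ξ (i + 1) / a i), F_pos (ξ i / a i)]

/-- The positive part of `ξ i`, with `ξ 0 = -∞`. -/
noncomputable def posEntry (ξ : ℕ → ℝ) (i : ℕ) : ℝ := if i = 0 then 0 else max (ξ i) 0

/-- The negative part of `ξ i`, with `ξ (n + 1) = +∞`. -/
noncomputable def negEntry (n : ℕ) (ξ : ℕ → ℝ) (i : ℕ) : ℝ :=
  if i = n + 1 then 0 else max (-ξ i) 0

theorem posEntry_nonneg (ξ : ℕ → ℝ) (i : ℕ) : 0 ≤ posEntry ξ i := by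
  unfold posEntry; split_ifs <;> simp

theorem negEntry_nonneg (n : ℕ) (ξ : ℕ → ℝ) (i : ℕ) : 0 ≤ negEntry n ξ i := by
  unfold negEntry; split_ifs <;> simp

theorem log_le_of_le_F_neg {x g : ℝ} (hx : 0 ≤ x) (hg : 0 < g) (h : g ≤ F (-x)) :
    log g ≤ -x ^ 2 / 4 - log (1 + x) := by
  have := log_le_log hg (h.trans (F_neg_le hx))
  rwa [log_div (exp_pos _).ne' (by linarith), log_exp] at this

theorem log_gap_le {n i : ℕ} {a ξ : ℕ → ℝ} (ha : 0 < a i) (h : 0 < gap n a ξ i) :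
    log (gap n a ξ i) ≤ -(posEntry ξ i ^ 2 + negEntry n ξ (i + 1) ^ 2) / (4 * a i ^ 2)
      - log (1 + posEntry ξ i / a i) - log (1 + negEntry n ξ (i + 1) / a i) := by
  rcases (posEntry_nonneg ξ i).eq_or_lt with hP | hP
  · rw [← hP]
    rcases (negEntry_nonneg n ξ (i + 1)).eq_or_lt with hQ | hQ
    · rw [← hQ]
      simpa using log_nonpos h.le (gap_le_one n a ξ i)
    · have hin : i ≠ n := by rintro rfl; simp [negEntry] at hQ
      have hval : negEntry n ξ (i + 1) = -ξ (i + 1) := by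
        simp only [negEntry, add_left_inj, hin, if_false] at hQ ⊢
        exact max_eq_left (by by_contra! hc; simp [max_eq_right hc.le] at hQ)
      have hle : gap n a ξ i ≤ F (-(negEntry n ξ (i + 1) / a i)) := by
        rw [hval, neg_div, neg_neg]
        simp only [gap, hin, if_false]
        split_ifs <;> linarith [F_pos (ξ i / a i)]
      refine (log_le_of_le_F_neg (by positivity) h hle).trans_eq ?_
      simp only [zero_div, add_zero, log_one]
      field_simp
      ring
  · have hi : i ≠ 0 := by rintro rfl; simp [posEntry] at hP
    have hval : posEntry ξ i = ξ i := by
      simp only [posEntry, hi, if_false] at hP ⊢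
      exact max_eq_left (by by_contra! hc; simp [max_eq_right hc.le] at hP)
    have hQ : negEntry n ξ (i + 1) = 0 := by
      by_cases hin : i = n
      · simp [negEntry, hin]
      · simp only [negEntry, add_left_inj, hin, if_false]
        exact max_eq_right (by linarith [lt_of_gap_pos hi hin ha h])
    have hle : gap n a ξ i ≤ F (-(posEntry ξ i / a i)) := by
      rw [hval]
      simp only [gap, hi, if_false]
      split_ifs <;> linarith [F_add_F_neg (ξ i / a i), F_lt_one (ξ (i + 1) / a i)]
    refine (log_le_of_le_F_neg (by positivity) h hle).trans_eq ?_
    rw [hQ]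
    simp only [zero_div, add_zero, log_one]
    field_simp
    ring

theorem prefix_sum_mul_nonneg {n : ℕ} (A q : ℕ → ℝ)
    (hA : ∀ j, 1 ≤ j → j ≤ n → 0 ≤ ∑ i ∈ Icc 1 j, A i) (hq0 : ∀ i, 0 ≤ q i)
    (hq : ∀ i, 1 ≤ i → i < n → q (i + 1) ≤ q i) : 0 ≤ ∑ i ∈ Icc 1 n, A i * q i := by
  have key : ∀ m ≤ n, (∑ i ∈ Icc 1 m, A i) * q m ≤ ∑ i ∈ Icc 1 m, A i * q i := by
    intro m
    induction m with
    | zero => simp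
    | succ m ih =>
      intro hm
      rw [sum_Icc_succ_top (by omega), sum_Icc_succ_top (by omega), add_mul]
      refine add_le_add_left (le_trans ?_ (ih (by omega))) _
      rcases Nat.eq_zero_or_pos m with rfl | hm0
      · simp
      · exact mul_le_mul_of_nonneg_left (hq m hm0 (by omega)) (hA m hm0 (by omega))
  rcases Nat.eq_zero_or_pos n with rfl | hn
  · simp
  · exact (mul_nonneg (hA n hn le_rfl) (hq0 n)).trans (key n le_rfl)

theorem suffix_sum_mul_nonneg {n : ℕ} (A p : ℕ → ℝ)
    (hA : ∀ j, 1 ≤ j → j ≤ n → 0 ≤ ∑ i ∈ Icc j n, A i) (hp0 : ∀ i, 0 ≤ p i)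
    (hp : ∀ i, 1 ≤ i → i < n → p i ≤ p (i + 1)) : 0 ≤ ∑ i ∈ Icc 1 n, A i * p i := by
  have hreflect : ∀ (f : ℕ → ℝ) (j : ℕ), 1 ≤ j → j ≤ n →
      ∑ i ∈ Icc 1 j, f (n + 1 - i) = ∑ i ∈ Icc (n + 1 - j) n, f i := by
    intro f j _ _
    refine sum_bij' (fun i _ => n + 1 - i) (fun i _ => n + 1 - i) ?_ ?_ ?_ ?_ ?_ <;>
      simp only [mem_Icc, implies_true] <;> omega
  rcases Nat.eq_zero_or_pos n with rfl | hn
  · simp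
  have h := prefix_sum_mul_nonneg (n := n) (fun i => A (n + 1 - i)) (fun i => p (n + 1 - i))
    (fun j h1 h2 => by rw [hreflect A j h1 h2]; exact hA _ (by omega) (by omega))
    (fun i => hp0 _) (fun i h1 h2 => by
      have := hp (n + 1 - (i + 1)) (by omega) (by omega)
      rwa [show n + 1 - (i + 1) + 1 = n + 1 - i by omega] at this)
  rw [hreflect (fun i => A i * p i) n hn le_rfl] at h
  simpa using h

theorem sum_Icc_one_eq_sum_range (n : ℕ) (f : ℕ → ℝ) :
    ∑ i ∈ Icc 1 n, f i = ∑ i ∈ range n, f (i + 1) := by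
  induction n with
  | zero => simp
  | succ n ih => rw [sum_Icc_succ_top (by omega), sum_range_succ, ih]

theorem E_eq (n : ℕ) (u a k d ξ : ℕ → ℝ) :
    E n u a k d ξ = -(∑ i ∈ range (n + 1), k i * (u (i + 1) - u i) * log (gap n a ξ i))
      + ∑ i ∈ Icc 1 n, d i * ξ i ^ 2 / 4 := rfl

/-- Coercivity of `E`. -/
theorem sum_log_le_E {n : ℕ} {u a k d ξ : ℕ → ℝ}
    (hu : ∀ i ≤ n, u i < u (i + 1)) (ha : ∀ i ≤ n, 0 < a i) (hk : ∀ i ≤ n, 0 < k i)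
    (hS1 : ∀ j, 1 ≤ j → j ≤ n →
      0 ≤ ∑ i ∈ Icc 1 j, (k (i - 1) / a (i - 1) ^ 2 * (u i - u (i - 1)) + d i))
    (hS2 : ∀ j, 1 ≤ j → j ≤ n →
      0 ≤ ∑ i ∈ Icc j n, (k i / a i ^ 2 * (u (i + 1) - u i) + d i))
    (hξ : ∀ i ≤ n, 0 < gap n a ξ i) :
    ∑ i ∈ range (n + 1), k i * (u (i + 1) - u i) *
      (log (1 + posEntry ξ i / a i) + log (1 + negEntry n ξ (i + 1) / a i)) ≤ E n u a k d ξ := by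
  have hmono : ∀ i, 1 ≤ i → i < n → ξ i < ξ (i + 1) := fun i h1 h2 =>
    lt_of_gap_pos (by omega) (by omega) (ha i h2.le) (hξ i h2.le)
  have hA := prefix_sum_mul_nonneg _ (fun i => max (-ξ i) 0 ^ 2) hS1 (fun i => sq_nonneg _)
    (fun i h1 h2 => pow_le_pow_left₀ (le_max_right _ _)
      (max_le_max_right _ (neg_le_neg (hmono i h1 h2).le)) 2)
  have hB := suffix_sum_mul_nonneg _ (fun i => max (ξ i) 0 ^ 2) hS2 (fun i => sq_nonneg _)
    (fun i h1 h2 => pow_le_pow_left₀ (le_max_right _ _)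
      (max_le_max_right _ (hmono i h1 h2).le) 2)
  have hterm : ∑ i ∈ range (n + 1), k i * (u (i + 1) - u i) * log (gap n a ξ i) ≤
      ∑ i ∈ range (n + 1), k i * (u (i + 1) - u i) *
        (-(posEntry ξ i ^ 2 + negEntry n ξ (i + 1) ^ 2) / (4 * a i ^ 2)
          - log (1 + posEntry ξ i / a i) - log (1 + negEntry n ξ (i + 1) / a i)) := by
    refine sum_le_sum fun i hi => ?_
    have hi' : i ≤ n := Nat.lt_succ_iff.1 (mem_range.1 hi)
    exact mul_le_mul_of_nonneg_left (log_gap_le (ha i hi') (hξ i hi'))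
      (mul_nonneg (hk i hi').le (sub_nonneg.2 (hu i hi').le))
  have hP : ∑ i ∈ range (n + 1), k i / a i ^ 2 * (u (i + 1) - u i) * posEntry ξ i ^ 2 =
      ∑ i ∈ Icc 1 n, k i / a i ^ 2 * (u (i + 1) - u i) * max (ξ i) 0 ^ 2 := by
    rw [sum_range_succ', sum_Icc_one_eq_sum_range]
    simp [posEntry]
  have hQ : ∑ i ∈ range (n + 1), k i / a i ^ 2 * (u (i + 1) - u i) * negEntry n ξ (i + 1) ^ 2 =
      ∑ i ∈ Icc 1 n, k (i - 1) / a (i - 1) ^ 2 * (u i - u (i - 1)) * max (-ξ i) 0 ^ 2 := by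
    rw [sum_range_succ, sum_Icc_one_eq_sum_range]
    simp only [negEntry, if_true, add_tsub_cancel_right]
    rw [zero_pow two_ne_zero, mul_zero, add_zero]
    refine sum_congr rfl fun i hi => ?_
    rw [if_neg (by have := mem_range.1 hi; omega)]
  have hd : ∑ i ∈ Icc 1 n, d i * ξ i ^ 2 / 4 =
      ((∑ i ∈ Icc 1 n, d i * max (-ξ i) 0 ^ 2) + ∑ i ∈ Icc 1 n, d i * max (ξ i) 0 ^ 2) / 4 := by
    rw [← sum_add_distrib, sum_div]
    refine sum_congr rfl fun i _ => ?_
    rcases le_total (ξ i) 0 with h | h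
    · rw [max_eq_right h, max_eq_left (by linarith)]; ring
    · rw [max_eq_left h, max_eq_right (by linarith)]; ring
  have hsplit : ∑ i ∈ range (n + 1), k i * (u (i + 1) - u i) *
        (-(posEntry ξ i ^ 2 + negEntry n ξ (i + 1) ^ 2) / (4 * a i ^ 2)
          - log (1 + posEntry ξ i / a i) - log (1 + negEntry n ξ (i + 1) / a i)) =
      -((∑ i ∈ range (n + 1), k i / a i ^ 2 * (u (i + 1) - u i) * posEntry ξ i ^ 2) +
        ∑ i ∈ range (n + 1), k i / a i ^ 2 * (u (i + 1) - u i) * negEntry n ξ (i + 1) ^ 2) / 4 -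
      ∑ i ∈ range (n + 1), k i * (u (i + 1) - u i) *
        (log (1 + posEntry ξ i / a i) + log (1 + negEntry n ξ (i + 1) / a i)) := by
    rw [← sum_add_distrib, ← sum_neg_distrib, sum_div, ← sum_sub_distrib]
    refine sum_congr rfl fun i hi => ?_
    have := ha i (Nat.lt_succ_iff.1 (mem_range.1 hi))
    field_simp
    ring
  simp only [add_mul, sum_add_distrib] at hA hB
  rw [E_eq]
  rw [hsplit, hP, hQ] at hterm
  linarith

/-- The function `exp (-E)`, extended by zero to the points where some gap is nonpositive. -/
noncomputable def expNegE (n : ℕ) (u a k d ξ : ℕ → ℝ) : ℝ :=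
  (∏ i ∈ range (n + 1), max (gap n a ξ i) 0 ^ (k i * (u (i + 1) - u i))) *
    exp (-∑ i ∈ Icc 1 n, d i * ξ i ^ 2 / 4)

theorem continuous_expNegE {n : ℕ} {u a k d : ℕ → ℝ}
    (hc : ∀ i ≤ n, 0 < k i * (u (i + 1) - u i)) : Continuous (expNegE n u a k d) := by
  refine Continuous.mul (continuous_finsetProd _ fun i hi => ?_) (by fun_prop)
  exact ((continuous_gap n a i).max continuous_const).rpow_const fun _ =>
    Or.inr (hc i (Nat.lt_succ_iff.1 (mem_range.1 hi))).le

theorem expNegE_eq {n : ℕ} {u a k d ξ : ℕ → ℝ} (hξ : ∀ i ≤ n, 0 < gap n a ξ i) :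
    expNegE n u a k d ξ = exp (-E n u a k d ξ) := by
  rw [expNegE, E_eq, neg_add, neg_neg, exp_add, exp_sum]
  congr 1
  refine prod_congr rfl fun i hi => ?_
  have h := hξ i (Nat.lt_succ_iff.1 (mem_range.1 hi))
  rw [max_eq_left h.le, rpow_def_of_pos h, mul_comm]

theorem gap_pos_of_expNegE_pos {n : ℕ} {u a k d ξ : ℕ → ℝ}
    (hc : ∀ i ≤ n, 0 < k i * (u (i + 1) - u i)) (h : 0 < expNegE n u a k d ξ) :
    ∀ i ≤ n, 0 < gap n a ξ i := by
  intro i hi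
  by_contra! hg
  refine h.ne' (mul_eq_zero_of_left (prod_eq_zero (mem_range.2 (Nat.lt_succ_iff.2 hi)) ?_) _)
  rw [max_eq_right hg, zero_rpow (hc i hi).ne']

theorem le_mul_exp_of_mul_log_le {x a c e : ℝ} (hx : 0 ≤ x) (ha : 0 < a) (hc : 0 < c)
    (h : c * log (1 + x / a) ≤ e) : x ≤ a * exp (e / c) := by
  have h1 : log (1 + x / a) ≤ e / c := by rwa [le_div_iff₀ hc, mul_comm]
  rw [log_le_iff_le_exp (by positivity)] at h1
  rw [mul_comm, ← div_le_iff₀ ha]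
  linarith

theorem exists_isMin_E {n : ℕ} {u a k d : ℕ → ℝ}
    (hu : ∀ i ≤ n, u i < u (i + 1)) (ha : ∀ i ≤ n, 0 < a i) (hk : ∀ i ≤ n, 0 < k i)
    (hS1 : ∀ j, 1 ≤ j → j ≤ n →
      0 ≤ ∑ i ∈ Icc 1 j, (k (i - 1) / a (i - 1) ^ 2 * (u i - u (i - 1)) + d i))
    (hS2 : ∀ j, 1 ≤ j → j ≤ n →
      0 ≤ ∑ i ∈ Icc j n, (k i / a i ^ 2 * (u (i + 1) - u i) + d i)) :
    ∃ ξ : ℕ → ℝ, (∀ i ∉ Icc 1 n, ξ i = 0) ∧ (∀ i ≤ n, 0 < gap n a ξ i) ∧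
      ∀ η : ℕ → ℝ, (∀ i ∉ Icc 1 n, η i = 0) → (∀ i ≤ n, 0 < gap n a η i) →
        E n u a k d ξ ≤ E n u a k d η := by
  have hc : ∀ i ≤ n, 0 < k i * (u (i + 1) - u i) := fun i hi =>
    mul_pos (hk i hi) (sub_pos.2 (hu i hi))
  let ξ₀ : ℕ → ℝ := fun i => if i ∈ Icc 1 n then (i : ℝ) else 0
  have hξ₀ : ∀ i ≤ n, 0 < gap n a ξ₀ i := fun i hi => gap_pos_of_lt (ha i hi) (by
    intro h0 hn
    simp only [ξ₀, mem_Icc]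
    rw [if_pos (by omega), if_pos (by omega)]
    push_cast
    linarith)
  set e := E n u a k d ξ₀
  let R : ℕ → ℝ := fun i => if i ∈ Icc 1 n then
    a i * exp (e / (k i * (u (i + 1) - u i))) +
      a (i - 1) * exp (e / (k (i - 1) * (u (i - 1 + 1) - u (i - 1)))) else 0
  let K : Set (ℕ → ℝ) := Set.univ.pi fun i => Set.Icc (-R i) (R i)
  have hK : IsCompact K := isCompact_univ_pi fun i => isCompact_Icc
  have hmem : ∀ η : ℕ → ℝ, (∀ i ∉ Icc 1 n, η i = 0) → (∀ i ≤ n, 0 < gap n a η i) →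
      E n u a k d η ≤ e → η ∈ K := by
    intro η hη0 hη hηe i _
    by_cases hi : i ∈ Icc 1 n
    · have hsum := (sum_log_le_E hu ha hk hS1 hS2 hη).trans hηe
      have hi' := mem_Icc.1 hi
      have hp : ∀ j ≤ n, 0 ≤ log (1 + posEntry η j / a j) := fun j hj => log_nonneg
        (le_add_of_nonneg_right (div_nonneg (posEntry_nonneg _ _) (ha j hj).le))
      have hq : ∀ j ≤ n, 0 ≤ log (1 + negEntry n η (j + 1) / a j) := fun j hj => log_nonneg
        (le_add_of_nonneg_right (div_nonneg (negEntry_nonneg _ _ _) (ha j hj).le))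
      have hone : ∀ j ≤ n, k j * (u (j + 1) - u j) *
          (log (1 + posEntry η j / a j) + log (1 + negEntry n η (j + 1) / a j)) ≤ e := by
        intro j hj
        refine (single_le_sum (f := fun j => k j * (u (j + 1) - u j) *
          (log (1 + posEntry η j / a j) + log (1 + negEntry n η (j + 1) / a j)))
          (fun l hl => ?_) (mem_range.2 (Nat.lt_succ_iff.2 hj))).trans hsum
        have hl' := Nat.lt_succ_iff.1 (mem_range.1 hl)
        exact mul_nonneg (hc l hl').le (add_nonneg (hp l hl') (hq l hl'))
      have h1 : posEntry η i ≤ a i * exp (e / (k i * (u (i + 1) - u i))) :=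
        le_mul_exp_of_mul_log_le (posEntry_nonneg _ _) (ha i hi'.2) (hc i hi'.2)
          (le_trans (mul_le_mul_of_nonneg_left (le_add_of_nonneg_right (hq i hi'.2))
            (hc i hi'.2).le) (hone i hi'.2))
      have hi1 : i - 1 ≤ n := by omega
      have h2 : negEntry n η (i - 1 + 1) ≤
          a (i - 1) * exp (e / (k (i - 1) * (u (i - 1 + 1) - u (i - 1)))) :=
        le_mul_exp_of_mul_log_le (negEntry_nonneg _ _ _) (ha _ hi1) (hc _ hi1)
          (le_trans (mul_le_mul_of_nonneg_left (le_add_of_nonneg_left (hp _ hi1))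
            (hc _ hi1).le) (hone _ hi1))
      have h3 : η i ≤ posEntry η i := by
        rw [posEntry, if_neg (by omega)]
        exact le_max_left _ _
      have h4 : -η i ≤ negEntry n η (i - 1 + 1) := by
        rw [negEntry, if_neg (by omega), Nat.sub_add_cancel hi'.1]
        exact le_max_left _ _
      have h5 : 0 ≤ a i * exp (e / (k i * (u (i + 1) - u i))) :=
        (posEntry_nonneg _ _).trans h1
      have h6 : 0 ≤ a (i - 1) * exp (e / (k (i - 1) * (u (i - 1 + 1) - u (i - 1)))) :=
        (negEntry_nonneg _ _ _).trans h2
      simp only [R, if_pos hi]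
      constructor <;> linarith
    · simp only [R, if_neg hi, hη0 i hi, neg_zero, Set.Icc_self, Set.mem_singleton_iff]
  have hξ₀K : ξ₀ ∈ K := hmem ξ₀ (fun i hi => if_neg hi) hξ₀ le_rfl
  obtain ⟨ξ, hξK, hmax⟩ := hK.exists_isMaxOn ⟨ξ₀, hξ₀K⟩
    (continuous_expNegE (a := a) (d := d) hc).continuousOn
  have hpos : 0 < expNegE n u a k d ξ :=
    (by rw [expNegE_eq hξ₀]; exact exp_pos _ : 0 < expNegE n u a k d ξ₀).trans_le (hmax hξ₀K)
  have hgap := gap_pos_of_expNegE_pos hc hpos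
  have hmin : ∀ η ∈ K, (∀ i ≤ n, 0 < gap n a η i) → E n u a k d ξ ≤ E n u a k d η := by
    intro η hηK hη
    have h : expNegE n u a k d η ≤ expNegE n u a k d ξ := hmax hηK
    rw [expNegE_eq hη, expNegE_eq hgap, exp_le_exp] at h
    linarith
  refine ⟨ξ, fun i hi => ?_, hgap, fun η hη0 hη => ?_⟩
  · have := hξK i trivial
    simp only [R, if_neg hi, neg_zero, Set.Icc_self, Set.mem_singleton_iff] at this
    exact this
  · rcases le_total (E n u a k d η) e with h | h
    · exact hmin η (hmem η hη0 hη h) hη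
    · exact (hmin ξ₀ hξ₀K hξ₀).trans h

theorem hasDerivAt_F_update_div (a : ℝ) (ξ : ℕ → ℝ) (i j : ℕ) :
    HasDerivAt (fun t => F (Function.update ξ i t j / a))
      (if j = i then F' (ξ i / a) / a else 0) (ξ i) := by
  by_cases h : j = i
  · subst h
    simp only [Function.update_self, if_true]
    have h := (hasDerivAt_F (ξ j / a)).comp (ξ j) ((hasDerivAt_id (ξ j)).div_const a)
    rwa [mul_one_div] at h
  · simp only [Function.update_of_ne h, if_neg h]
    exact hasDerivAt_const _ _

theorem hasDerivAt_gap_update (n : ℕ) (a ξ : ℕ → ℝ) {i : ℕ} (hi : i ∈ Icc 1 n) (j : ℕ) :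
    HasDerivAt (fun t => gap n a (Function.update ξ i t) j)
      ((if j + 1 = i then F' (ξ i / a j) / a j else 0) -
        (if j = i then F' (ξ i / a j) / a j else 0)) (ξ i) := by
  have hi' := mem_Icc.1 hi
  unfold gap
  refine HasDerivAt.sub ?_ ?_
  · by_cases h : j = n
    · simp only [h, if_true]
      rw [if_neg (by omega)]
      exact hasDerivAt_const _ _
    · simp only [h, if_false]
      exact hasDerivAt_F_update_div _ _ _ _
  · by_cases h : j = 0
    · simp only [h, if_true]
      rw [if_neg (by omega)]
      exact hasDerivAt_const _ _
    · simp only [h, if_false]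
      exact hasDerivAt_F_update_div _ _ _ _

/-- The partial derivatives of `E` are the left-hand sides of the Stefan system. -/
theorem hasDerivAt_E_update {n : ℕ} {u a k d ξ : ℕ → ℝ} (hξ : ∀ i ≤ n, 0 < gap n a ξ i)
    {i : ℕ} (hi : i ∈ Icc 1 n) :
    HasDerivAt (fun t => E n u a k d (Function.update ξ i t)) (stefanLHS n u a k d ξ i)
      (ξ i) := by
  have hi' := mem_Icc.1 hi
  have hlog : ∀ j ∈ range (n + 1), HasDerivAt
      (fun t => k j * (u (j + 1) - u j) * log (gap n a (Function.update ξ i t) j))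
      ((if j + 1 = i then k j * (u (j + 1) - u j) * (F' (ξ i / a j) / a j / gap n a ξ j) else 0) -
        (if j = i then k j * (u (j + 1) - u j) * (F' (ξ i / a j) / a j / gap n a ξ j) else 0))
      (ξ i) := by
    intro j hj
    have hj' := Nat.lt_succ_iff.1 (mem_range.1 hj)
    have h := ((hasDerivAt_gap_update n a ξ hi j).log
      (by rw [Function.update_eq_self]; exact (hξ j hj').ne')).const_mul (k j * (u (j + 1) - u j))
    refine h.congr_deriv ?_
    rw [Function.update_eq_self]
    split_ifs <;> ring
  have hsq : ∀ j ∈ Icc 1 n, HasDerivAt (fun t => d j * Function.update ξ i t j ^ 2 / 4)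
      (if j = i then d j * ξ j / 2 else 0) (ξ i) := by
    intro j _
    by_cases h : j = i
    · subst h
      simp only [Function.update_self, if_true]
      refine (((hasDerivAt_pow 2 (ξ j)).const_mul (d j)).div_const 4).congr_deriv ?_
      norm_num
      ring
    · simp only [Function.update_of_ne h, if_neg h]
      exact hasDerivAt_const _ _
  refine ((HasDerivAt.fun_sum hlog).neg.add (HasDerivAt.fun_sum hsq)).congr_deriv ?_
  obtain ⟨m, rfl⟩ : ∃ m, i = m + 1 := ⟨i - 1, by omega⟩
  have h1 : m < n := by omega
  have hg := hξ m h1.le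
  have hg' := hξ (m + 1) hi'.2
  rw [sum_sub_distrib]
  simp only [add_left_inj, sum_ite_eq', mem_range, hi, if_true]
  rw [if_pos (by omega), if_pos (by omega)]
  simp only [stefanLHS, gap, add_tsub_cancel_right, Nat.add_eq_right, h1.ne, if_false,
    Nat.succ_ne_zero, div_div, mul_div_assoc]
  ring

/-- Under the coercivity conditions there exist `ξ₁ < ⋯ < ξ_n` solving the Stefan system,
i.e. an increasing self-similar solution of the multi-phase Stefan–Riemann problem exists. -/
theorem stmt9 (n : ℕ) (hn : 1 ≤ n) (u a k d : ℕ → ℝ)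
    (hu : ∀ i ≤ n, u i < u (i + 1))
    (ha : ∀ i ≤ n, 0 < a i)
    (hk : ∀ i ≤ n, 0 < k i)
    (hS1 : ∀ j, 1 ≤ j → j ≤ n →
      0 ≤ ∑ i ∈ Finset.Icc 1 j, (k (i - 1) / a (i - 1) ^ 2 * (u i - u (i - 1)) + d i))
    (hS2 : ∀ j, 1 ≤ j → j ≤ n →
      0 ≤ ∑ i ∈ Finset.Icc j n, (k i / a i ^ 2 * (u (i + 1) - u i) + d i)) :
    ∃ ξ : ℕ → ℝ, (∀ i, 1 ≤ i → i < n → ξ i < ξ (i + 1)) ∧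
      ∀ i, 1 ≤ i → i ≤ n → stefanLHS n u a k d ξ i = 0 := by
  obtain ⟨ξ, hξ0, hgap, hmin⟩ := exists_isMin_E hu ha hk hS1 hS2
  refine ⟨ξ, fun i h1 h2 => lt_of_gap_pos (by omega) (by omega) (ha i h2.le) (hgap i h2.le),
    fun i h1 h2 => ?_⟩
  have hi : i ∈ Icc 1 n := mem_Icc.2 ⟨h1, h2⟩
  refine IsLocalMin.hasDerivAt_eq_zero ?_ (hasDerivAt_E_update hgap hi)
  have hev : ∀ᶠ t in nhds (ξ i), ∀ j ∈ range (n + 1), 0 < gap n a (Function.update ξ i t) j := by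
    rw [eventually_all_finset]
    intro j hj
    have hj' := Nat.lt_succ_iff.1 (mem_range.1 hj)
    refine (hasDerivAt_gap_update n a ξ hi j).continuousAt.eventually (lt_mem_nhds ?_)
    simpa only [Function.update_eq_self] using hgap j hj'
  filter_upwards [hev] with t ht
  rw [Function.update_eq_self]
  refine hmin _ (fun j hj => ?_) (fun j hj => ht j (mem_range.2 (Nat.lt_succ_iff.2 hj)))
  rw [Function.update_of_ne (by rintro rfl; exact hj hi), hξ0 j hj]
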